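/- arXiv:math/0203105 — 2 statements merged into one kernel-verified Lean document; each statement's English description precedes it below -/
import Mathlib

section
/- Let k ≥ 0. Every vector (z, z') ∈ K_{j+1}^+ ∪ K_{j+1}^- with ‖z‖_1 ≤ k can be written as a finite positive-integer combination Σ_i α_i (g_i, g'_i) with α_i ∈ ℤ_{>0}, (g_i, g'_i) ∈ 𝒢_{≤k}, and (g_i, g'_i) ⊑_{j+1} (z, z') for all i. -/
/-- Projection of a vector onto its first `j` coordinates. -/
def proj {α : Type*} (n j : ℕ) (h : j ≤ n) (v : Fin n → α) : Fin j → α :=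
  fun i => v (Fin.castLE h i)

/-- Projection onto the first `j + 1` coordinates, presented as a pair
    (first `j` coordinates, `(j+1)`-st coordinate). -/
def projPair {α : Type*} (n j : ℕ) (h : j + 1 ≤ n) (v : Fin n → α) : (Fin j → α) × α :=
  (fun i => v (Fin.castLE h i.castSucc), v ⟨j, h⟩)

/-- The lattice `Λ ⊆ ℤ^n` generated by the vectors `p_1, …, p_s`. -/
def latticeOf {n s : ℕ} (p : Fin s → Fin n → ℤ) : AddSubgroup (Fin n → ℤ) :=
  AddSubgroup.closure (Set.range p)

/-- `K_j := π_j(Λ)`. -/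
def KProj (n s j : ℕ) (h : j ≤ n) (p : Fin s → Fin n → ℤ) : Set (Fin j → ℤ) :=
  proj n j h '' (latticeOf p : Set (Fin n → ℤ))

/-- `K_j^+`: the elements of `K_j` with all coordinates nonnegative. -/
def KProjPlus (n s j : ℕ) (h : j ≤ n) (p : Fin s → Fin n → ℤ) : Set (Fin j → ℤ) :=
  {z ∈ KProj n s j h p | ∀ i, 0 ≤ z i}

/-- `K_{j+1} := π_{j+1}(Λ)`, in pair form. -/
def KPair (n s j : ℕ) (h : j + 1 ≤ n) (p : Fin s → Fin n → ℤ) : Set ((Fin j → ℤ) × ℤ) :=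
  projPair n j h '' (latticeOf p : Set (Fin n → ℤ))

/-- `K_{j+1}^+`: first `j` coordinates nonnegative and last coordinate nonnegative. -/
def KPairPlus (n s j : ℕ) (h : j + 1 ≤ n) (p : Fin s → Fin n → ℤ) : Set ((Fin j → ℤ) × ℤ) :=
  {z ∈ KPair n s j h p | (∀ i, 0 ≤ z.1 i) ∧ 0 ≤ z.2}

/-- `K_{j+1}^-`: first `j` coordinates nonnegative and last coordinate nonpositive. -/
def KPairMinus (n s j : ℕ) (h : j + 1 ≤ n) (p : Fin s → Fin n → ℤ) : Set ((Fin j → ℤ) × ℤ) :=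
  {z ∈ KPair n s j h p | (∀ i, 0 ≤ z.1 i) ∧ z.2 ≤ 0}

/-- The partial order `u ⊑_{j+1} v`. -/
def sqle {j : ℕ} (u v : (Fin j → ℤ) × ℤ) : Prop :=
  (∀ i, u.1 i ≤ v.1 i) ∧ |u.2| ≤ |v.2| ∧ 0 ≤ u.2 * v.2

/-- `z` is a finite nonnegative-integer combination of elements of `F`. -/
def IsNNComb {α : Type*} [AddCommMonoid α] (F : Set α) (z : α) : Prop :=
  ∃ c : α →₀ ℕ, ↑c.support ⊆ F ∧ z = c.sum fun a k => k • a

/-- `z` is a finite nonnegative-integer combination of elements of `F`, all of which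
satisfy the predicate `P` (the coefficients on the support are automatically positive). -/
def IsNNCombP {α : Type*} [AddCommMonoid α] (F : Set α) (P : α → Prop) (z : α) : Prop :=
  ∃ c : α →₀ ℕ, ↑c.support ⊆ F ∧ (∀ a ∈ c.support, P a) ∧ z = c.sum fun a k => k • a

/-- `z` is an irreducible element of (the monoid) `S`: it is a nonzero element of `S`
that is not the sum of two nonzero elements of `S`. -/
def IsIrred {α : Type*} [AddCommMonoid α] (S : Set α) (z : α) : Prop :=
  z ∈ S ∧ z ≠ 0 ∧ ∀ x ∈ S, ∀ y ∈ S, x ≠ 0 → y ≠ 0 → z ≠ x + y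

/-- If a weight that is additive on the submonoid `M` vanishes only at `0`, then every element of `M`
is a combination of irreducible elements of `M`, each a summand of it with remainder in `M`. -/
theorem isNNCombP_isIrred_of_weight {α : Type*} [AddCommMonoid α] (M : AddSubmonoid α)
    (w : α → ℕ) (w_add : ∀ x ∈ M, ∀ y ∈ M, w (x + y) = w x + w y)
    (w_pos : ∀ x ∈ M, x ≠ 0 → 0 < w x) {z : α} (hz : z ∈ M) :
    IsNNCombP {g | IsIrred (M : Set α) g} (fun g => ∃ r ∈ M, z = g + r) z := by
  classical
  induction hm : w z using Nat.strong_induction_on generalizing z with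
  | _ m ih =>
  subst hm
  by_cases hz0 : z = 0
  · exact ⟨0, by simp, by simp, by simp [hz0]⟩
  by_cases hirr : IsIrred (M : Set α) z
  · refine ⟨Finsupp.single z 1, ?_, ?_, by simp⟩
    · intro a ha
      have : a = z := by simpa using Finsupp.support_single_subset ha
      exact this ▸ hirr
    · intro a ha
      have : a = z := by simpa using Finsupp.support_single_subset ha
      exact ⟨0, M.zero_mem, by simp [this]⟩
  · obtain ⟨x, hx, y, hy, hx0, hy0, rfl⟩ :
        ∃ x ∈ M, ∃ y ∈ M, x ≠ 0 ∧ y ≠ 0 ∧ z = x + y := by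
      by_contra! h
      exact hirr ⟨hz, hz0, h⟩
    have hxy := w_add x hx y hy
    have hwx := w_pos x hx hx0
    have hwy := w_pos y hy hy0
    obtain ⟨c, hcF, hcP, hc⟩ := ih (w x) (by omega) hx rfl
    obtain ⟨d, hdF, hdP, hd⟩ := ih (w y) (by omega) hy rfl
    refine ⟨c + d, ?_, ?_, ?_⟩
    · intro a ha
      rcases Finset.mem_union.1 (Finsupp.support_add ha) with h | h
      exacts [hcF h, hdF h]
    · intro a ha
      rcases Finset.mem_union.1 (Finsupp.support_add ha) with h | h
      · obtain ⟨r, hr, hxr⟩ := hcP a h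
        exact ⟨r + y, M.add_mem hr hy, by rw [hxr, add_assoc]⟩
      · obtain ⟨r, hr, hyr⟩ := hdP a h
        exact ⟨x + r, M.add_mem hx hr, by rw [hyr, add_left_comm]⟩
    · rw [Finsupp.sum_add_index' (by simp) (fun a m n => add_nsmul a m n), ← hc, ← hd]

theorem zero_mem_KPair {n s j : ℕ} (h : j + 1 ≤ n) (p : Fin s → Fin n → ℤ) :
    0 ∈ KPair n s j h p :=
  ⟨0, (latticeOf p).zero_mem, rfl⟩

theorem add_mem_KPair {n s j : ℕ} {h : j + 1 ≤ n} {p : Fin s → Fin n → ℤ}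
    {x y : (Fin j → ℤ) × ℤ} (hx : x ∈ KPair n s j h p) (hy : y ∈ KPair n s j h p) :
    x + y ∈ KPair n s j h p := by
  obtain ⟨u, hu, rfl⟩ := hx
  obtain ⟨v, hv, rfl⟩ := hy
  exact ⟨u + v, (latticeOf p).add_mem hu hv, rfl⟩

/-- `K_{j+1}^+` as a submonoid. -/
def KPairPlusSubmonoid (n s j : ℕ) (h : j + 1 ≤ n) (p : Fin s → Fin n → ℤ) :
    AddSubmonoid ((Fin j → ℤ) × ℤ) where
  carrier := KPairPlus n s j h p
  zero_mem' := ⟨zero_mem_KPair h p, fun _ => le_rfl, le_rfl⟩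
  add_mem' hx hy := ⟨add_mem_KPair hx.1 hy.1, fun i => add_nonneg (hx.2.1 i) (hy.2.1 i),
    add_nonneg hx.2.2 hy.2.2⟩

/-- `K_{j+1}^-` as a submonoid. -/
def KPairMinusSubmonoid (n s j : ℕ) (h : j + 1 ≤ n) (p : Fin s → Fin n → ℤ) :
    AddSubmonoid ((Fin j → ℤ) × ℤ) where
  carrier := KPairMinus n s j h p
  zero_mem' := ⟨zero_mem_KPair h p, fun _ => le_rfl, le_rfl⟩
  add_mem' hx hy := ⟨add_mem_KPair hx.1 hy.1, fun i => add_nonneg (hx.2.1 i) (hy.2.1 i),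
    add_nonpos hx.2.2 hy.2.2⟩

/-- In a submonoid whose elements have nonnegative first coordinates and last coordinates of
pairwise equal sign, every element is a combination of irreducible elements `⊑` it. -/
theorem isNNCombP_isIrred_sqle {j : ℕ} (M : AddSubmonoid ((Fin j → ℤ) × ℤ))
    (nonneg : ∀ x ∈ M, ∀ i, 0 ≤ x.1 i) (sign : ∀ x ∈ M, ∀ y ∈ M, 0 ≤ x.2 * y.2)
    {z : (Fin j → ℤ) × ℤ} (hz : z ∈ M) :
    IsNNCombP {g | IsIrred (M : Set ((Fin j → ℤ) × ℤ)) g} (fun g => sqle g z) z := by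
  have abs_add_snd : ∀ x ∈ M, ∀ y ∈ M, |x.2 + y.2| = |x.2| + |y.2| := fun x hx y hy =>
    abs_add_eq_add_abs_iff _ _ |>.2 (mul_nonneg_iff.1 (sign x hx y hy))
  let w : (Fin j → ℤ) × ℤ → ℕ := fun x => ∑ i, (x.1 i).natAbs + x.2.natAbs
  have w_add : ∀ x ∈ M, ∀ y ∈ M, w (x + y) = w x + w y := by
    intro x hx y hy
    have hsnd : (x.2 + y.2).natAbs = x.2.natAbs + y.2.natAbs := by
      have := mul_nonneg_iff.1 (sign x hx y hy)
      omega
    have hfst : ∀ i, (x.1 i + y.1 i).natAbs = (x.1 i).natAbs + (y.1 i).natAbs := fun i =>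
      Int.natAbs_add_of_nonneg (nonneg x hx i) (nonneg y hy i)
    simp only [w, Prod.fst_add, Prod.snd_add, Pi.add_apply, hsnd, hfst, Finset.sum_add_distrib]
    omega
  have w_pos : ∀ x ∈ M, x ≠ 0 → 0 < w x := by
    intro x _ hx0
    refine Nat.pos_of_ne_zero fun h => hx0 ?_
    simp only [w, Nat.add_eq_zero_iff, Finset.sum_eq_zero_iff, Finset.mem_univ, true_implies,
      Int.natAbs_eq_zero] at h
    exact Prod.ext (funext h.1) h.2
  obtain ⟨c, hcF, hcP, hc⟩ := isNNCombP_isIrred_of_weight M w w_add w_pos hz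
  refine ⟨c, hcF, fun a ha => ?_, hc⟩
  have haM : a ∈ M := (hcF ha).1
  obtain ⟨r, hr, rfl⟩ := hcP a ha
  refine ⟨fun i => ?_, ?_, sign a haM _ hz⟩
  · have := nonneg r hr i
    simpa using this
  · rw [Prod.snd_add, abs_add_snd a haM r hr]
    exact le_add_of_nonneg_right (abs_nonneg _)

/-- Lemma 3.1: every `(z, z') ∈ K_{j+1}^+ ∪ K_{j+1}^-` with `‖z‖₁ ≤ k` is a finite
positive-integer combination of elements of `𝒢_{≤k}` (the irreducible elements of
`K_{j+1}^+ ∪ K_{j+1}^-` of norm at most `k`), each of which is `⊑_{j+1} (z, z')`. -/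
theorem stmt3 (n s j : ℕ) (hs : 1 ≤ s) (hsn : s ≤ n) (hj : 1 ≤ j) (hjn : j + 1 ≤ n)
    (p : Fin s → Fin n → ℤ)
    (hech1 : ∀ (i : Fin s) (k : Fin n), (k : ℕ) < (i : ℕ) → p i k = 0)
    (hech2 : ∀ i : Fin s, 0 < p i ⟨(i : ℕ), lt_of_lt_of_le i.isLt hsn⟩)
    (k : ℕ) :
    ∀ z ∈ KPairPlus n s j hjn p ∪ KPairMinus n s j hjn p,
      (∑ i, z.1 i) ≤ (k : ℤ) →
      IsNNCombP
        {g : (Fin j → ℤ) × ℤ |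
          (IsIrred (KPairPlus n s j hjn p) g ∨ IsIrred (KPairMinus n s j hjn p) g) ∧
          (∑ i, g.1 i) ≤ (k : ℤ)}
        (fun g => sqle g z) z := by
  rintro z (hz | hz) hzk
  · obtain ⟨c, hcF, hcP, hc⟩ := isNNCombP_isIrred_sqle (KPairPlusSubmonoid n s j hjn p)
      (fun x hx => hx.2.1) (fun x hx y hy => mul_nonneg hx.2.2 hy.2.2) hz
    exact ⟨c, fun a ha => ⟨Or.inl (hcF ha),
      (Finset.sum_le_sum fun i _ => (hcP a ha).1 i).trans hzk⟩, hcP, hc⟩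
  · obtain ⟨c, hcF, hcP, hc⟩ := isNNCombP_isIrred_sqle (KPairMinusSubmonoid n s j hjn p)
      (fun x hx => hx.2.1) (fun x hx y hy => mul_nonneg_of_nonpos_of_nonpos hx.2.2 hy.2.2) hz
    exact ⟨c, fun a ha => ⟨Or.inr (hcF ha),
      (Finset.sum_le_sum fun i _ => (hcP a ha).1 i).trans hzk⟩, hcP, hc⟩
end

section
/- Let R ⊆ K̄_j^+ generate the cone K̄_j^+ over ℝ_+, and for each h ∈ R fix a real number h'(h) with (h, h'(h)) ∈ K̄_{j+1}. Define F := {(h, h'(h)) : h ∈ R} if j ≥ s, and F := {(h, h'(h)) : h ∈ R} ∪ {π_{j+1}(p_{j+1}), −π_{j+1}(p_{j+1})} if j < s. Then every z ∈ K̄_{j+1}^+ ∪ K̄_{j+1}^- can be written as a finite nonnegative-real combination of elements of F. -/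
/-- The real linear span `L ⊆ ℝ^n` of the integer vectors `p_1, …, p_s`. -/
def spanR {n s : ℕ} (p : Fin s → Fin n → ℤ) : Set (Fin n → ℝ) :=
  (Submodule.span ℝ (Set.range fun i => fun k : Fin n => (p i k : ℝ)) : Submodule ℝ (Fin n → ℝ))

/-- `K̄_j := π_j(L)`. -/
def KRProj (n s j : ℕ) (h : j ≤ n) (p : Fin s → Fin n → ℤ) : Set (Fin j → ℝ) :=
  proj n j h '' spanR p

/-- `K̄_j^+`: the elements of `K̄_j` with all coordinates nonnegative. -/
def KRProjPlus (n s j : ℕ) (h : j ≤ n) (p : Fin s → Fin n → ℤ) : Set (Fin j → ℝ) :=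
  {z ∈ KRProj n s j h p | ∀ i, 0 ≤ z i}

/-- `K̄_{j+1} := π_{j+1}(L)`, in pair form. -/
def KRPair (n s j : ℕ) (h : j + 1 ≤ n) (p : Fin s → Fin n → ℤ) : Set ((Fin j → ℝ) × ℝ) :=
  projPair n j h '' spanR p

/-- `K̄_{j+1}^+`: first `j` coordinates nonnegative and last coordinate nonnegative. -/
def KRPairPlus (n s j : ℕ) (h : j + 1 ≤ n) (p : Fin s → Fin n → ℤ) : Set ((Fin j → ℝ) × ℝ) :=
  {z ∈ KRPair n s j h p | (∀ i, 0 ≤ z.1 i) ∧ 0 ≤ z.2}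

/-- `K̄_{j+1}^-`: first `j` coordinates nonnegative and last coordinate nonpositive. -/
def KRPairMinus (n s j : ℕ) (h : j + 1 ≤ n) (p : Fin s → Fin n → ℤ) : Set ((Fin j → ℝ) × ℝ) :=
  {z ∈ KRPair n s j h p | (∀ i, 0 ≤ z.1 i) ∧ z.2 ≤ 0}

/-- `z` is a finite nonnegative-real combination of elements of `F`. -/
def IsNNRComb {α : Type*} [AddCommMonoid α] [Module ℝ α] (F : Set α) (z : α) : Prop :=
  ∃ c : α →₀ ℝ, ↑c.support ⊆ F ∧ (∀ a, 0 ≤ c a) ∧ z = c.sum fun a r => r • a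

theorem IsNNRComb.zero {α : Type*} [AddCommMonoid α] [Module ℝ α] (F : Set α) :
    IsNNRComb F 0 :=
  ⟨0, by simp, by simp, by simp⟩

theorem IsNNRComb.add {α : Type*} [AddCommMonoid α] [Module ℝ α] {F : Set α} {x y : α}
    (hx : IsNNRComb F x) (hy : IsNNRComb F y) : IsNNRComb F (x + y) := by
  classical
  obtain ⟨c, hc, hc0, rfl⟩ := hx
  obtain ⟨d, hd, hd0, rfl⟩ := hy
  refine ⟨c + d, fun a ha => ?_, fun a => add_nonneg (hc0 a) (hd0 a), ?_⟩
  · rcases Finset.mem_union.1 (Finsupp.support_add ha) with h | h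
    exacts [hc h, hd h]
  · rw [Finsupp.sum_add_index' (fun a => zero_smul ℝ a) (fun a r t => add_smul r t a)]

theorem IsNNRComb.smul_mem {α : Type*} [AddCommMonoid α] [Module ℝ α] {F : Set α} {x : α}
    (hx : x ∈ F) {r : ℝ} (hr : 0 ≤ r) : IsNNRComb F (r • x) := by
  classical
  refine ⟨Finsupp.single x r, fun a ha => ?_, fun a => ?_, ?_⟩
  · rwa [Finset.mem_singleton.1 (Finsupp.support_single_subset ha)]
  · rw [Finsupp.single_apply]
    split_ifs
    exacts [hr, le_rfl]
  · rw [Finsupp.sum_single_index (zero_smul ℝ x)]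

theorem IsNNRComb.sum {α ι : Type*} [AddCommMonoid α] [Module ℝ α] {F : Set α} (t : Finset ι)
    (f : ι → α) (hf : ∀ i ∈ t, IsNNRComb F (f i)) : IsNNRComb F (∑ i ∈ t, f i) :=
  Finset.sum_induction f (IsNNRComb F) (fun _ _ => IsNNRComb.add) (IsNNRComb.zero F) hf

/-- `projPair` as a linear map. -/
def projPairLin (n j : ℕ) (h : j + 1 ≤ n) : (Fin n → ℝ) →ₗ[ℝ] (Fin j → ℝ) × ℝ where
  toFun := projPair n j h
  map_add' _ _ := rfl
  map_smul' _ _ := rfl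

/-- `KRPair` as a submodule. -/
def krPairSubmodule (n s j : ℕ) (h : j + 1 ≤ n) (p : Fin s → Fin n → ℤ) :
    Submodule ℝ ((Fin j → ℝ) × ℝ) :=
  (Submodule.span ℝ (Set.range fun i => fun k : Fin n => (p i k : ℝ))).map (projPairLin n j h)

theorem mem_krPairSubmodule {n s j : ℕ} {h : j + 1 ≤ n} {p : Fin s → Fin n → ℤ}
    {z : (Fin j → ℝ) × ℝ} : z ∈ krPairSubmodule n s j h p ↔ z ∈ KRPair n s j h p :=
  Iff.rfl

/-- If a combination of vectors in echelon form vanishes on its first `j` coordinates, then so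
do its first `j` coefficients. -/
theorem echelon_coeff_eq_zero {n s j : ℕ} (hsn : s ≤ n) (p : Fin s → Fin n → ℤ)
    (hech1 : ∀ (i : Fin s) (k : Fin n), (k : ℕ) < (i : ℕ) → p i k = 0)
    (hech2 : ∀ i : Fin s, 0 < p i ⟨(i : ℕ), lt_of_lt_of_le i.isLt hsn⟩)
    (a : Fin s → ℝ) (ha : ∀ k : Fin n, (k : ℕ) < j → ∑ i, a i * (p i k : ℝ) = 0) :
    ∀ (m : ℕ) (hm : m < s), m < j → a ⟨m, hm⟩ = 0 := by
  intro m
  induction m using Nat.strong_induction_on with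
  | _ m ih =>
    intro hm hmj
    have h := ha ⟨m, hm.trans_le hsn⟩ hmj
    rw [Finset.sum_eq_single (⟨m, hm⟩ : Fin s)] at h
    · exact (mul_eq_zero.1 h).resolve_right (by exact_mod_cast (hech2 ⟨m, hm⟩).ne')
    · intro i _ hi
      rcases lt_or_gt_of_ne (fun e => hi (Fin.ext e) : (i : ℕ) ≠ m) with hlt | hgt
      · rw [ih i hlt i.isLt (hlt.trans hmj), zero_mul]
      · rw [hech1 i _ hgt, Int.cast_zero, mul_zero]
    · simp

theorem eq_sum_of_mem_KRPair_of_fst_eq_zero {n s j : ℕ} (hsn : s ≤ n) (hjn : j + 1 ≤ n)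
    (p : Fin s → Fin n → ℤ)
    (hech1 : ∀ (i : Fin s) (k : Fin n), (k : ℕ) < (i : ℕ) → p i k = 0)
    (hech2 : ∀ i : Fin s, 0 < p i ⟨(i : ℕ), lt_of_lt_of_le i.isLt hsn⟩)
    {w : (Fin j → ℝ) × ℝ} (hw : w ∈ KRPair n s j hjn p) (hw0 : w.1 = 0) :
    ∃ a : Fin s → ℝ, (∀ i : Fin s, (i : ℕ) ≠ j →
        a i • projPair n j hjn (fun k => (p i k : ℝ)) = 0) ∧
      w = ∑ i, a i • projPair n j hjn (fun k => (p i k : ℝ)) := by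
  obtain ⟨v, hv, rfl⟩ := hw
  obtain ⟨a, rfl⟩ := (Submodule.mem_span_range_iff_exists_fun ℝ).1 hv
  refine ⟨a, fun i hi => ?_, ?_⟩
  · rcases lt_or_gt_of_ne hi with hlt | hgt
    · rw [echelon_coeff_eq_zero hsn p hech1 hech2 a (fun k hk => ?_) i i.isLt hlt, zero_smul]
      simpa [projPair, Fin.castLE] using congrFun hw0 ⟨k, hk⟩
    · have h0 : projPair n j hjn (fun k => (p i k : ℝ)) = 0 := by
        refine Prod.ext (funext fun k => ?_) ?_
        · simpa [projPair] using hech1 i (Fin.castLE hjn k.castSucc) (k.isLt.trans hgt)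
        · simpa [projPair] using hech1 i ⟨j, hjn⟩ hgt
      rw [h0, smul_zero]
  · change projPairLin n j hjn _ = _
    rw [map_sum]
    rfl

/-- Lemma 4.1: if `R` generates the cone `K̄_j^+` over `ℝ_+`, and for each `h ∈ R` we fix a
lift `(h, h'(h)) ∈ K̄_{j+1}`, then `F` (as defined by cases on `j ≥ s` vs `j < s`) generates
`K̄_{j+1}^+ ∪ K̄_{j+1}^-` over `ℝ_+`. -/
theorem stmt6 (n s j : ℕ) (hs : 1 ≤ s) (hsn : s ≤ n) (hj : 1 ≤ j) (hjn : j + 1 ≤ n)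
    (p : Fin s → Fin n → ℤ)
    (hech1 : ∀ (i : Fin s) (k : Fin n), (k : ℕ) < (i : ℕ) → p i k = 0)
    (hech2 : ∀ i : Fin s, 0 < p i ⟨(i : ℕ), lt_of_lt_of_le i.isLt hsn⟩)
    (R : Set (Fin j → ℝ))
    (hRsub : R ⊆ KRProjPlus n s j (Nat.le_of_succ_le hjn) p)
    (hRgen : ∀ z ∈ KRProjPlus n s j (Nat.le_of_succ_le hjn) p, IsNNRComb R z)
    (h' : (Fin j → ℝ) → ℝ)
    (hh' : ∀ h ∈ R, (h, h' h) ∈ KRPair n s j hjn p)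
    (F : Set ((Fin j → ℝ) × ℝ))
    (hF1 : s ≤ j → F = (fun h => (h, h' h)) '' R)
    (hF2 : ∀ hjs : j < s,
      F = (fun h => (h, h' h)) '' R ∪
          {projPair n j hjn (fun k => (p ⟨j, hjs⟩ k : ℝ)),
           -projPair n j hjn (fun k => (p ⟨j, hjs⟩ k : ℝ))}) :
    ∀ z ∈ KRPairPlus n s j hjn p ∪ KRPairMinus n s j hjn p, IsNNRComb F z := by
  intro z hz
  obtain ⟨hzK, hz0⟩ : z ∈ KRPair n s j hjn p ∧ ∀ i, 0 ≤ z.1 i := by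
    rcases hz with hz | hz
    exacts [⟨hz.1, hz.2.1⟩, ⟨hz.1, hz.2.1⟩]
  have hz1 : z.1 ∈ KRProjPlus n s j (Nat.le_of_succ_le hjn) p := by
    obtain ⟨v, hv, rfl⟩ := hzK
    exact ⟨⟨v, hv, rfl⟩, hz0⟩
  obtain ⟨c, hcR, hc0, hcz⟩ := hRgen _ hz1
  have hRF : ∀ h ∈ R, (h, h' h) ∈ F := by
    intro h hh
    rcases le_or_gt s j with hsj | hjs
    · rw [hF1 hsj]
      exact ⟨h, hh, rfl⟩
    · rw [hF2 hjs]
      exact Or.inl ⟨h, hh, rfl⟩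
  set y : (Fin j → ℝ) × ℝ := ∑ h ∈ c.support, c h • (h, h' h) with hy
  have hyF : IsNNRComb F y :=
    IsNNRComb.sum _ _ fun h hh => IsNNRComb.smul_mem (hRF h (hcR hh)) (hc0 h)
  have hyK : y ∈ krPairSubmodule n s j hjn p :=
    Submodule.sum_mem _ fun h hh =>
      Submodule.smul_mem _ _ (mem_krPairSubmodule.2 (hh' h (hcR hh)))
  have hwK : z - y ∈ KRPair n s j hjn p :=
    mem_krPairSubmodule.1 (Submodule.sub_mem _ (mem_krPairSubmodule.2 hzK) hyK)
  have hw0 : (z - y).1 = 0 := by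
    rw [Prod.fst_sub, hcz, hy, Prod.fst_sum, sub_eq_zero]
    rfl
  obtain ⟨a, ha, hw⟩ :=
    eq_sum_of_mem_KRPair_of_fst_eq_zero hsn hjn p hech1 hech2 hwK hw0
  rw [← add_sub_cancel y z, hw]
  refine hyF.add (IsNNRComb.sum _ _ fun i _ => ?_)
  by_cases hi : (i : ℕ) = j
  · subst hi
    rw [hF2 i.isLt]
    rcases le_total 0 (a i) with h0 | h0
    · exact IsNNRComb.smul_mem (Set.mem_union_right _ (Set.mem_insert _ _)) h0
    · rw [← neg_smul_neg (a i)]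
      exact IsNNRComb.smul_mem (Set.mem_union_right _ (Set.mem_insert_of_mem _ (Set.mem_singleton _)))
        (neg_nonneg.2 h0)
  · rw [ha i hi]
    exact IsNNRComb.zero F
end
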